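/- (Evolution of the three-term coefficients, Theorem on K-coefficients) In the stated setting, for every n ≥ 0 and every t: dK_0(n;t)/dt = V_{−1}(n;t)K_1(n−1;t) − K_1(n;t)V_{−1}(n+1;t), and dK_{−1}(n;t)/dt = V_{−2}(n;t)K_1(n−2;t) + V_{−1}(n;t)K_0(n−1;t) − K_1(n;t)V_{−2}(n+1;t) − K_0(n;t)V_{−1}(n;t) (terms with out-of-range indices vanish by the stated conventions). -/

import Mathlib

open Matrix Polynomial

/-- Evaluation of a matrix polynomial at a real point: `p(x) = Σ pᵢ xⁱ`. -/
noncomputable def mEval {N : ℕ} (p : Polynomial (Matrix (Fin N) (Fin N) ℂ)) (x : ℝ) :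
    Matrix (Fin N) (Fin N) ℂ :=
  p.eval ((x : ℂ) • (1 : Matrix (Fin N) (Fin N) ℂ))

section MatrixPolynomial

variable {N : ℕ}

theorem mEval_apply (p : Polynomial (Matrix (Fin N) (Fin N) ℂ)) (x : ℝ) (i j : Fin N) :
    mEval p x i j = ((matPolyEquiv.symm p) i j).eval (x : ℂ) := by
  have h := matPolyEquiv_eval (matPolyEquiv.symm p) (x : ℂ) i j
  rw [AlgEquiv.apply_symm_apply] at h
  rw [← h, mEval, Matrix.scalar_apply, Matrix.smul_one_eq_diagonal]

theorem mEval_mul (p q : Polynomial (Matrix (Fin N) (Fin N) ℂ)) (x : ℝ) :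
    mEval (p * q) x = mEval p x * mEval q x :=
  eval₂_mul_noncomm _ _ fun _ => (Commute.one_right _).smul_right _

theorem mEval_C_mul (A : Matrix (Fin N) (Fin N) ℂ) (p : Polynomial (Matrix (Fin N) (Fin N) ℂ))
    (x : ℝ) : mEval (C A * p) x = A * mEval p x :=
  eval_C_mul

theorem mEval_add (p q : Polynomial (Matrix (Fin N) (Fin N) ℂ)) (x : ℝ) :
    mEval (p + q) x = mEval p x + mEval q x :=
  eval_add

theorem mEval_sum {ι : Type*} (s : Finset ι) (p : ι → Polynomial (Matrix (Fin N) (Fin N) ℂ))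
    (x : ℝ) : mEval (∑ m ∈ s, p m) x = ∑ m ∈ s, mEval (p m) x :=
  eval_finsetSum _ _ _

/-- Complex polynomials that agree at all real points are equal. -/
theorem Polynomial.eq_of_eval_ofReal_eq {p q : Polynomial ℂ}
    (h : ∀ x : ℝ, p.eval (x : ℂ) = q.eval (x : ℂ)) : p = q :=
  eq_of_infinite_eval_eq p q <|
    (Set.infinite_range_of_injective Complex.ofReal_injective).mono <| by
      rintro _ ⟨x, rfl⟩
      exact h x

theorem mEval_injective {p q : Polynomial (Matrix (Fin N) (Fin N) ℂ)}
    (h : ∀ x : ℝ, mEval p x = mEval q x) : p = q := by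
  apply matPolyEquiv.symm.injective
  ext1 i j
  refine Polynomial.eq_of_eval_ofReal_eq fun x => ?_
  rw [← mEval_apply, ← mEval_apply, h]

theorem mEval_apply_eq_sum (p : Polynomial (Matrix (Fin N) (Fin N) ℂ)) {M : ℕ}
    (hM : p.natDegree < M) (x : ℝ) (i j : Fin N) :
    mEval p x i j = ∑ d ∈ Finset.range M, p.coeff d i j * (x : ℂ) ^ d := by
  rw [mEval, eval_eq_sum_range' hM, Matrix.sum_apply]
  refine Finset.sum_congr rfl fun d _ => ?_
  rw [_root_.smul_pow, one_pow, mul_smul_comm, mul_one, Matrix.smul_apply, smul_eq_mul, mul_comm]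

/-- If the values of a differentiable family of matrix polynomials of bounded degree have as
derivatives the values of `Q`, then its coefficients have as derivatives those of `Q`. -/
theorem hasDerivAt_coeff_of_mEval {a b t : ℝ} (ht : t ∈ Set.Ioo a b)
    {p : ℝ → Polynomial (Matrix (Fin N) (Fin N) ℂ)} {n : ℕ}
    (hdeg : ∀ s ∈ Set.Ioo a b, (p s).natDegree ≤ n) {i j : Fin N}
    (hdiff : ∀ d : ℕ, DifferentiableOn ℝ (fun s => (p s).coeff d i j) (Set.Ioo a b))
    {Q : Polynomial (Matrix (Fin N) (Fin N) ℂ)}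
    (hQ : ∀ x : ℝ, HasDerivAt (fun s => mEval (p s) x i j) (mEval Q x i j) t) (d : ℕ) :
    HasDerivAt (fun s => (p s).coeff d i j) (Q.coeff d i j) t := by
  have hnhds : Set.Ioo a b ∈ nhds t := isOpen_Ioo.mem_nhds ht
  have hD (e : ℕ) : HasDerivAt (fun s => (p s).coeff e i j)
      (deriv (fun s => (p s).coeff e i j) t) t :=
    ((hdiff e).differentiableAt hnhds).hasDerivAt
  set D : ℕ → ℂ := fun e => deriv (fun s => (p s).coeff e i j) t
  have hsum (x : ℝ) : HasDerivAt (fun s => mEval (p s) x i j)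
      (∑ e ∈ Finset.range (n + d + 1), D e * (x : ℂ) ^ e) t := by
    refine (HasDerivAt.fun_sum fun e _ => (hD e).mul_const ((x : ℂ) ^ e)).congr_of_eventuallyEq ?_
    filter_upwards [hnhds] with s hs
    exact mEval_apply_eq_sum _ (by have := hdeg s hs; omega) x i j
  have hpoly : ∑ e ∈ Finset.range (n + d + 1), C (D e) * X ^ e = (matPolyEquiv.symm Q) i j := by
    refine Polynomial.eq_of_eval_ofReal_eq fun x => ?_
    rw [← mEval_apply, (hQ x).unique (hsum x), eval_finsetSum]
    simp
  have hcoeff := congrArg (fun r => r.coeff d) hpoly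
  simp only [finsetSum_coeff, coeff_C_mul_X_pow, matPolyEquiv_symm_apply_coeff,
    Finset.sum_ite_eq, Finset.mem_range] at hcoeff
  rw [if_pos (by omega)] at hcoeff
  rw [← hcoeff]
  exact hD d

/-- Entrywise product rule for matrix-valued functions. -/
theorem hasDerivAt_matrix_mul_apply {A B : ℝ → Matrix (Fin N) (Fin N) ℂ}
    {A' B' : Matrix (Fin N) (Fin N) ℂ} {t : ℝ}
    (hA : ∀ i j, HasDerivAt (fun s => A s i j) (A' i j) t)
    (hB : ∀ i j, HasDerivAt (fun s => B s i j) (B' i j) t) (i j : Fin N) :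
    HasDerivAt (fun s => (A s * B s) i j) ((A' * B t + A t * B') i j) t := by
  simp only [Matrix.add_apply, Matrix.mul_apply, ← Finset.sum_add_distrib]
  exact HasDerivAt.fun_sum fun k _ => (hA i k).mul (hB k j)

theorem hasDerivAt_matrix_mul_const_apply {A : ℝ → Matrix (Fin N) (Fin N) ℂ}
    {A' : Matrix (Fin N) (Fin N) ℂ} {t : ℝ}
    (hA : ∀ i j, HasDerivAt (fun s => A s i j) (A' i j) t)
    (B : Matrix (Fin N) (Fin N) ℂ) (i j : Fin N) :
    HasDerivAt (fun s => (A s * B) i j) ((A' * B) i j) t := by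
  simpa using hasDerivAt_matrix_mul_apply (B' := 0) hA
    (fun i j => hasDerivAt_const t (B i j)) i j

theorem hasDerivAt_matrix_const_mul_apply {B : ℝ → Matrix (Fin N) (Fin N) ℂ}
    {B' : Matrix (Fin N) (Fin N) ℂ} {t : ℝ} (A : Matrix (Fin N) (Fin N) ℂ)
    (hB : ∀ i j, HasDerivAt (fun s => B s i j) (B' i j) t) (i j : Fin N) :
    HasDerivAt (fun s => (A * B s) i j) ((A * B') i j) t := by
  simpa using hasDerivAt_matrix_mul_apply (A' := 0)
    (fun i j => hasDerivAt_const t (A i j)) hB i j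

end MatrixPolynomial

/-- **Evolution of the three-term coefficients (Theorem on K-coefficients).**
`Λ` is a fixed matrix polynomial of degree one; the monic matrix polynomials `P n t` satisfy the
three-term relation `P_n Λ = K_1(n)P_{n+1} + K_0(n)P_n + K_{-1}(n)P_{n-1}` and the time evolution
`∂P_n/∂t = Σ_{m=0}^{n-1} V_{m-n}(n;t)P_m`, with the vanishing conventions.  Then `K_0` and
`K_{-1}` satisfy the stated evolution equations. -/
theorem three_term_coefficients_evolution
    (N : ℕ) (hN : 1 ≤ N)
    (a b : ℝ) -- `t` ranges over the open interval `Set.Ioo a b`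
    (Λ : Polynomial (Matrix (Fin N) (Fin N) ℂ))
    (hΛdeg : Λ.natDegree = 1)
    (P : ℤ → ℝ → Polynomial (Matrix (Fin N) (Fin N) ℂ))
    (hPneg : ∀ m : ℤ, m < 0 → ∀ t, P m t = 0)
    (hPmonic : ∀ n : ℤ, 0 ≤ n → ∀ t ∈ Set.Ioo a b, (P n t).Monic ∧ (P n t).natDegree = n.toNat)
    (hPdiff : ∀ n : ℤ, ∀ d : ℕ, ∀ i j,
      DifferentiableOn ℝ (fun t => ((P n t).coeff d) i j) (Set.Ioo a b))
    (K : ℤ → ℤ → ℝ → Matrix (Fin N) (Fin N) ℂ)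
    (hKzero : ∀ j n : ℤ, ∀ t : ℝ, (n < 0 ∨ n + j < 0) → K j n t = 0)
    (hKdiff : ∀ m n : ℤ, ∀ i j, DifferentiableOn ℝ (fun t => (K m n t) i j) (Set.Ioo a b))
    (hKrel : ∀ n : ℤ, 0 ≤ n → ∀ t ∈ Set.Ioo a b, ∀ x : ℝ,
      mEval (P n t) x * mEval Λ x =
        K 1 n t * mEval (P (n + 1) t) x + K 0 n t * mEval (P n t) x +
          K (-1) n t * mEval (P (n - 1) t) x)
    (V : ℤ → ℤ → ℝ → Matrix (Fin N) (Fin N) ℂ)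
    (hVzero : ∀ j n : ℤ, ∀ t : ℝ, (n < 0 ∨ n + j < 0) → V j n t = 0)
    (hVrel : ∀ n : ℤ, 0 ≤ n → ∀ t ∈ Set.Ioo a b, ∀ x : ℝ, ∀ i j,
      HasDerivAt (fun s => (mEval (P n s) x) i j)
        ((∑ m ∈ Finset.range n.toNat, V ((m : ℤ) - n) n t * mEval (P (m : ℤ) t) x) i j) t)
    :
    ∀ n : ℤ, 0 ≤ n → ∀ t ∈ Set.Ioo a b, ∀ i j,
      HasDerivAt (fun s => (K 0 n s) i j)
        ((V (-1) n t * K 1 (n - 1) t - K 1 n t * V (-1) (n + 1) t) i j) t ∧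
      HasDerivAt (fun s => (K (-1) n s) i j)
        ((V (-2) n t * K 1 (n - 2) t + V (-1) n t * K 0 (n - 1) t -
          K 1 n t * V (-2) (n + 1) t - K 0 n t * V (-1) n t) i j) t := by
  set L₁ := Λ.coeff 1
  set L₀ := Λ.coeff 0
  have hΛ : Λ = C L₁ * X + C L₀ := eq_X_add_C_of_natDegree_le_one hΛdeg.le
  have hmon (n : ℕ) {t : ℝ} (ht : t ∈ Set.Ioo a b) : (P n t).coeff n = 1 := by
    obtain ⟨h₁, h₂⟩ := hPmonic n (by positivity) t ht
    rw [Int.toNat_natCast] at h₂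
    simpa only [h₂] using h₁.coeff_natDegree
  have hdeg (n : ℕ) {t : ℝ} (ht : t ∈ Set.Ioo a b) : (P n t).natDegree = n := by
    simpa using (hPmonic n (by positivity) t ht).2
  have hvan (n : ℕ) {t : ℝ} (ht : t ∈ Set.Ioo a b) {d : ℕ} (hd : n < d) :
      (P n t).coeff d = 0 :=
    coeff_eq_zero_of_natDegree_lt (by rwa [hdeg n ht])
  have hrel (n : ℕ) {t : ℝ} (ht : t ∈ Set.Ioo a b) :
      P n t * X * C L₁ + P n t * C L₀ =
        C (K 1 n t) * P (n + 1 : ℕ) t + C (K 0 n t) * P n t + C (K (-1) n t) * P (n - 1) t := by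
    rw [mul_assoc, X_mul_C, ← mul_add, ← hΛ]
    refine mEval_injective fun x => ?_
    simp only [mEval_add, mEval_C_mul]
    rw [mEval_mul]
    exact_mod_cast hKrel n (by positivity) t ht x
  -- the subleading coefficients of `P n t`, zero when out of range
  set p : ℕ → ℝ → Matrix (Fin N) (Fin N) ℂ := fun n t => (P n t * X).coeff n with hp
  set q : ℕ → ℝ → Matrix (Fin N) (Fin N) ℂ := fun n t => (P n t * X * X).coeff n with hq
  have hK1 (n : ℕ) {t : ℝ} (ht : t ∈ Set.Ioo a b) : K 1 n t = L₁ := by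
    have h := congrArg (fun r => r.coeff (n + 1)) (hrel n ht)
    have hlow : (P (n - 1) t).coeff (n + 1) = 0 := by
      cases n with
      | zero => rw [hPneg _ (by simp), coeff_zero]
      | succ k => simpa using hvan k ht (d := k + 1 + 1) (by omega)
    simp only [coeff_add, coeff_mul_C, coeff_C_mul, coeff_mul_X, hlow, hmon _ ht,
      hvan n ht (Nat.lt_succ_self n)] at h
    simpa using h.symm
  have hK0 (n : ℕ) {t : ℝ} (ht : t ∈ Set.Ioo a b) :
      K 0 n t = L₀ + p n t * L₁ - L₁ * p (n + 1) t := by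
    have h := congrArg (fun r => (r * X).coeff (n + 1)) (hrel n ht)
    have hlow : (P (n - 1) t).coeff n = 0 := by
      cases n with
      | zero => rw [hPneg _ (by simp), coeff_zero]
      | succ k => simpa using hvan k ht (d := k + 1) (by omega)
    simp only [coeff_add, coeff_mul_C, coeff_C_mul, coeff_mul_X, hlow, hmon _ ht, hK1 n ht] at h
    simp only [hp, coeff_mul_X]
    rw [mul_one, one_mul, mul_zero, add_zero] at h
    rw [add_comm, h]
    abel
  have hKm1 (k : ℕ) {t : ℝ} (ht : t ∈ Set.Ioo a b) :
      K (-1) (k + 1 : ℕ) t = p (k + 1) t * L₀ + q (k + 1) t * L₁ - L₁ * q (k + 2) t -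
        K 0 (k + 1 : ℕ) t * p (k + 1) t := by
    have h := congrArg (fun r => r.coeff k) (hrel (k + 1) ht)
    have hlead : (P ((k + 1 : ℕ) - 1) t).coeff k = 1 := by simpa using hmon k ht
    simp only [coeff_add, coeff_mul_C, coeff_C_mul, hlead, hK1 _ ht] at h
    simp only [hp, hq, coeff_mul_X]
    rw [mul_one] at h
    rw [add_comm (_ * L₀), h]
    abel
  have hder (n : ℕ) {t : ℝ} (ht : t ∈ Set.Ioo a b) (d : ℕ) (i j : Fin N) :
      HasDerivAt (fun s => (P n s).coeff d i j)
        ((∑ m ∈ Finset.range n, V ((m : ℤ) - n) n t * (P m t).coeff d) i j) t := by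
    have h := hasDerivAt_coeff_of_mEval ht (fun s hs => (hdeg n hs).le)
      (fun d => hPdiff n d i j)
      (Q := ∑ m ∈ Finset.range n, C (V ((m : ℤ) - n) n t) * P m t) (fun x => by
        simpa only [mEval_sum, mEval_C_mul, Int.toNat_natCast] using
          hVrel n (by positivity) t ht x i j) d
    simpa only [finsetSum_coeff, coeff_C_mul] using h
  have hlow (k : ℕ) {t : ℝ} (ht : t ∈ Set.Ioo a b) (W : ℕ → Matrix (Fin N) (Fin N) ℂ) :
      ∑ m ∈ Finset.range k, W m * (P m t).coeff k = 0 :=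
    Finset.sum_eq_zero fun m hm => by rw [hvan m ht (Finset.mem_range.1 hm), mul_zero]
  have hp' (n : ℕ) {t : ℝ} (ht : t ∈ Set.Ioo a b) (i j : Fin N) :
      HasDerivAt (fun s => p n s i j) (V (-1) n t i j) t := by
    cases n with
    | zero =>
      rw [hVzero (-1) _ t (by simp)]
      simpa [hp] using hasDerivAt_const t (0 : ℂ)
    | succ k =>
      have h := hder (k + 1) ht k i j
      rw [Finset.sum_range_succ, hlow k ht, hmon k ht, zero_add, mul_one] at h
      simpa only [hp, coeff_mul_X, Nat.cast_succ, sub_add_cancel_left] using h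
  have hq' (k : ℕ) {t : ℝ} (ht : t ∈ Set.Ioo a b) (i j : Fin N) :
      HasDerivAt (fun s => q (k + 1) s i j)
        ((V (-2) (k + 1 : ℕ) t + V (-1) (k + 1 : ℕ) t * p k t) i j) t := by
    cases k with
    | zero =>
      rw [hVzero (-2) _ t (by simp)]
      simpa [hp, hq] using hasDerivAt_const t (0 : ℂ)
    | succ k =>
      have h := hder (k + 2) ht k i j
      rw [Finset.sum_range_succ, Finset.sum_range_succ, hlow k ht, hmon k ht, zero_add,
        mul_one] at h
      have e₁ : (k : ℤ) - (k + 2 : ℕ) = -2 := by push_cast; ring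
      have e₂ : ((k + 1 : ℕ) : ℤ) - (k + 2 : ℕ) = -1 := by push_cast; ring
      rw [e₁, e₂] at h
      simpa only [hp, hq, coeff_mul_X] using h
  have hK0' (n : ℕ) {t : ℝ} (ht : t ∈ Set.Ioo a b) (i j : Fin N) :
      HasDerivAt (fun s => K 0 n s i j)
        ((V (-1) n t * L₁ - L₁ * V (-1) (n + 1 : ℕ) t) i j) t := by
    refine HasDerivAt.congr_of_eventuallyEq
      (((hasDerivAt_matrix_mul_const_apply (hp' n ht) L₁ i j).const_add (L₀ i j)).sub
        (hasDerivAt_matrix_const_mul_apply L₁ (hp' (n + 1) ht) i j)) ?_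
    filter_upwards [isOpen_Ioo.mem_nhds ht] with s hs
    rw [hK0 n hs]
    rfl
  intro n hn t ht i j
  lift n to ℕ using hn
  cases n with
  | zero =>
    refine ⟨?_, ?_⟩
    · have h := hK0' 0 ht i j
      rw [hVzero (-1) (0 : ℕ) t (by simp), zero_mul] at h ⊢
      rw [hK1 0 ht]
      exact h
    · have hzero : (fun s => K (-1) (0 : ℕ) s i j) = fun _ => 0 := by
        funext s
        rw [hKzero (-1) _ s (by simp), Matrix.zero_apply]
      rw [hzero, hVzero (-2) (0 : ℕ) t (by simp), hVzero (-1) (0 : ℕ) t (by simp),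
        hVzero (-2) ((0 : ℕ) + 1) t (by simp)]
      simpa using hasDerivAt_const t (0 : ℂ)
  | succ k =>
    have e₁ : ((k + 1 : ℕ) : ℤ) - 1 = k := by push_cast; ring
    have e₂ : ((k + 1 : ℕ) : ℤ) + 1 = (k + 2 : ℕ) := by push_cast; ring
    have hV2 : V (-2) (k + 1 : ℕ) t * K 1 ((k + 1 : ℕ) - 2) t = V (-2) (k + 1 : ℕ) t * L₁ := by
      cases k with
      | zero => rw [hVzero (-2) _ t (by simp), zero_mul, zero_mul]
      | succ l =>
        have e : ((l + 1 + 1 : ℕ) : ℤ) - 2 = l := by push_cast; ring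
        rw [e, hK1 l ht]
    rw [hV2, e₁, e₂, hK1 k ht, hK1 (k + 1) ht]
    refine ⟨hK0' (k + 1) ht i j, ?_⟩
    have h := (((hasDerivAt_matrix_mul_const_apply (hp' (k + 1) ht) L₀ i j).add
      (hasDerivAt_matrix_mul_const_apply (hq' k ht) L₁ i j)).sub
      (hasDerivAt_matrix_const_mul_apply L₁ (hq' (k + 1) ht) i j)).sub
      (hasDerivAt_matrix_mul_apply (hK0' (k + 1) ht) (hp' (k + 1) ht) i j)
    simp only [← Matrix.add_apply, ← Matrix.sub_apply] at h
    refine (h.congr_deriv ?_).congr_of_eventuallyEq ?_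
    · rw [hK0 k ht]
      refine congrArg (fun M : Matrix (Fin N) (Fin N) ℂ => M i j) ?_
      simp only [mul_add, mul_sub, add_mul, sub_mul, mul_assoc]
      abel
    · filter_upwards [isOpen_Ioo.mem_nhds ht] with s hs
      rw [hKm1 k hs]
      rfl
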